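/- arXiv:2510.24513 — 9 statements merged into one kernel-verified Lean document; each statement's English description precedes it below -/
import Mathlib

section
/- Let X be an orthoset. The following are equivalent: (a) for any finite collection A₁, …, A_k of orthoclosed subsets of X that are mutually orthogonal (A_i ⊆ A_j^⊥ for i ≠ j) and whose join ⋁_i A_i equals X, one has A_i = (⋁_{j ≠ i} A_j)^⊥ for each i = 1, …, k; (b) C(X) is an orthomodular lattice, i.e., for orthoclosed B ⊆ A one has A = B ∨ (A ∩ B^⊥). -/
class Orthoset (X : Type*) extends Zero X where
  perp : X → X → Prop
  perp_comm : ∀ x y : X, perp x y → perp y x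
  perp_self : ∀ x : X, perp x x → x = 0
  zero_perp : ∀ x : X, perp 0 x

namespace Orthoset

variable {X : Type*} [Orthoset X]

/-- The orthocomplement of a subset of an orthoset. -/
def ortho (A : Set X) : Set X := {x : X | ∀ y ∈ A, perp x y}

/-- A subset is orthoclosed if it equals its double orthocomplement. -/
def Orthoclosed (A : Set X) : Prop := ortho (ortho A) = A

end Orthoset

open Orthoset

namespace Orthoset

variable {X : Type*} [Orthoset X]

theorem ortho_anti {A B : Set X} (h : A ⊆ B) : ortho B ⊆ ortho A :=
  fun _ hx y hy => hx y (h hy)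

theorem subset_oo (A : Set X) : A ⊆ ortho (ortho A) :=
  fun x hx y hy => perp_comm _ _ (hy x hx)

theorem ooo (A : Set X) : ortho (ortho (ortho A)) = ortho A :=
  Set.Subset.antisymm (ortho_anti (subset_oo A)) (subset_oo _)

theorem subset_ortho_comm {A B : Set X} (h : A ⊆ ortho B) : B ⊆ ortho A :=
  fun x hx y hy => perp_comm _ _ (h hy x hx)

theorem mem_both {A : Set X} {x : X} (h : x ∈ A) (h' : x ∈ ortho A) : x = 0 :=
  perp_self x (h' x h)

end Orthoset

/-- For an orthoset `X`, the following are equivalent: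
(a) every finite family of mutually orthogonal orthoclosed subsets whose join is `X`
    is a decomposition, i.e. each member is the orthocomplement of the join of the others;
(b) `C(X)` is orthomodular: for orthoclosed `B ⊆ A` one has `A = B ∨ (A ∩ B^⊥)`. -/
theorem stmt0 {X : Type*} [Orthoset X] :
    (∀ (k : ℕ) (A : Fin k → Set X),
        (∀ i, Orthoclosed (A i)) →
        (∀ i j, i ≠ j → A i ⊆ ortho (A j)) →
        ortho (ortho (⋃ i, A i)) = Set.univ →
        ∀ i, A i = ortho (ortho (ortho (⋃ j ∈ {j : Fin k | j ≠ i}, A j)))) ↔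
    (∀ A B : Set X, Orthoclosed A → Orthoclosed B → B ⊆ A →
        A = ortho (ortho (B ∪ (A ∩ ortho B)))) := by
  constructor
  · intro H A B hA hB hBA
    have h12 : B ⊆ ortho (A ∩ ortho B) := subset_ortho_comm Set.inter_subset_right
    have h13 : B ⊆ ortho (ortho A) := by rw [hA]; exact hBA
    have h23 : A ∩ ortho B ⊆ ortho (ortho A) := by rw [hA]; exact Set.inter_subset_left
    have hC : Orthoclosed (A ∩ ortho B) := by
      apply Set.Subset.antisymm _ (subset_oo _)
      intro x hx
      constructor
      · rw [← hA]
        exact ortho_anti (ortho_anti Set.inter_subset_left) hx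
      · rw [← ooo B]
        exact ortho_anti (ortho_anti Set.inter_subset_right) hx
    have key := H 3 ![B, A ∩ ortho B, ortho A] ?_ ?_ ?_ 2
    · rw [ooo] at key
      have hU : (⋃ j ∈ {j : Fin 3 | j ≠ 2}, (![B, A ∩ ortho B, ortho A] : Fin 3 → Set X) j)
          = B ∪ (A ∩ ortho B) := by
        ext x
        simp only [Set.mem_iUnion, Set.mem_ofPred_eq, Fin.exists_fin_succ]
        simp
      rw [hU] at key
      rw [← key]
      exact hA.symm
    · intro i
      fin_cases i
      · exact hB
      · exact hC
      · exact ooo A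
    · intro i j hij
      fin_cases i <;> fin_cases j
      · exact absurd rfl hij
      · exact h12
      · exact h13
      · exact Set.inter_subset_right
      · exact absurd rfl hij
      · exact h23
      · exact ortho_anti hBA
      · exact ortho_anti Set.inter_subset_left
      · exact absurd rfl hij
    · apply Set.eq_univ_of_forall
      intro z y hy
      have hsub : ∀ i, y ∈ ortho ((![B, A ∩ ortho B, ortho A] : Fin 3 → Set X) i) :=
        fun i => ortho_anti (Set.subset_iUnion _ i) hy
      have h0 : y ∈ ortho B := hsub 0
      have h1 : y ∈ ortho (A ∩ ortho B) := hsub 1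
      have h2 : y ∈ ortho (ortho A) := hsub 2
      rw [hA] at h2
      rw [mem_both (A := A ∩ ortho B) ⟨h2, h0⟩ h1]
      exact perp_comm _ _ (zero_perp z)
  · intro H k A hA hperp htop i
    have hsub : A i ⊆ ortho (⋃ j ∈ {j : Fin k | j ≠ i}, A j) := by
      intro x hx y hy
      simp only [Set.mem_iUnion, Set.mem_ofPred_eq] at hy
      obtain ⟨j, hj, hy⟩ := hy
      exact hperp i j (Ne.symm hj) hx y hy
    rw [ooo]
    have key := H _ (A i) (ooo _) (hA i) hsub
    apply Set.Subset.antisymm hsub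
    rw [key]
    have : A i ∪ (ortho (⋃ j ∈ {j : Fin k | j ≠ i}, A j) ∩ ortho (A i)) ⊆ ortho (ortho (A i)) := by
      rintro x (hx | ⟨hx1, hx2⟩)
      · exact subset_oo _ hx
      · have hx : x ∈ ortho (⋃ j, A j) := by
          intro y hy
          obtain ⟨j, hy⟩ := Set.mem_iUnion.1 hy
          by_cases hj : j = i
          · subst hj; exact hx2 y hy
          · exact hx1 y (Set.mem_biUnion (x := j) hj hy)
        have hx' : x ∈ ortho (ortho (⋃ j, A j)) := by rw [htop]; trivial
        rw [mem_both hx hx']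
        exact fun y _ => zero_perp y
    have h2 := ortho_anti (ortho_anti this)
    rw [ooo, hA i] at h2
    exact h2
end

section
/- Let X be an orthoset. Then C(X) is an orthomodular lattice if and only if for every orthoclosed subset A of X and every B ⊆ A, the double orthocomplement of B computed within the orthoset A coincides with the one computed in X, i.e., (B^⊥ ∩ A)^⊥ ∩ A = B^⊥⊥. -/
open Orthoset

theorem aux_anti {X : Type*} [Orthoset X] {A B : Set X} (h : A ⊆ B) : ortho B ⊆ ortho A :=
  fun _ hx y hy => hx y (h hy)

theorem aux_le {X : Type*} [Orthoset X] (A : Set X) : A ⊆ ortho (ortho A) :=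
  fun x hx _ hy => perp_comm _ _ (hy x hx)

theorem aux_triple {X : Type*} [Orthoset X] (A : Set X) : ortho (ortho (ortho A)) = ortho A :=
  Set.Subset.antisymm (aux_anti (aux_le A)) (aux_le _)

theorem aux_union {X : Type*} [Orthoset X] (A B : Set X) :
    ortho (A ∪ B) = ortho A ∩ ortho B := by
  ext x
  constructor
  · intro h
    exact ⟨fun y hy => h y (Or.inl hy), fun y hy => h y (Or.inr hy)⟩
  · rintro ⟨h1, h2⟩ y (hy | hy)
    · exact h1 y hy
    · exact h2 y hy

/-- `C(X)` is orthomodular iff for every orthoclosed `A` and every `B ⊆ A`, the double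
orthocomplement of `B` computed within the orthoset `A` (with relative orthocomplement
`B ↦ B^⊥ ∩ A`) coincides with the one computed in `X`:
`(B^⊥ ∩ A)^⊥ ∩ A = B^⊥⊥`. -/
theorem stmt1 {X : Type*} [Orthoset X] :
    (∀ A B : Set X, Orthoclosed A → Orthoclosed B → B ⊆ A →
        A = ortho (ortho (B ∪ (A ∩ ortho B)))) ↔
    (∀ A B : Set X, Orthoclosed A → B ⊆ A →
        ortho (ortho B ∩ A) ∩ A = ortho (ortho B)) := by
  constructor
  · intro H A B hA hBA
    have hCA : ortho (ortho B) ⊆ A := by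
      have := aux_anti (aux_anti hBA)
      rwa [show ortho (ortho A) = A from hA] at this
    have hCD : ortho (ortho B) ⊆ ortho (ortho B ∩ A) ∩ A :=
      fun x hx => ⟨fun y hy => hx y hy.1, hCA hx⟩
    have hD : Orthoclosed (ortho (ortho B ∩ A) ∩ A) := by
      have e : ortho (ortho B ∩ A) ∩ A = ortho ((ortho B ∩ A) ∪ ortho A) := by
        rw [aux_union, show ortho (ortho A) = A from hA]
      rw [e]
      exact aux_triple _
    refine Set.Subset.antisymm ?_ hCD
    have h := H _ _ hD (aux_triple (ortho B)) hCD
    intro x hx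
    rw [h] at hx
    intro y hy
    apply hx
    rintro z (hz | ⟨⟨hz1, hz2⟩, hz3⟩)
    · exact perp_comm _ _ (hz y hy)
    · rw [aux_triple] at hz3
      rw [perp_self z (hz1 z ⟨hz3, hz2⟩)]
      exact perp_comm _ _ (zero_perp y)
  · intro H A B hA hB hBA
    have h := H (ortho B) (ortho A) (aux_triple B) (aux_anti hBA)
    rw [show ortho (ortho A) = A from hA] at h
    rw [aux_union, Set.inter_comm, h]
    exact hA.symm
end

section
/- Let X be an orthoset. (i) For any proper element x ∈ X, the subspace {x}^⊥⊥, regarded as an orthoset with the restricted relation, is unital. (ii) If X is a Dacey space, then every unital orthoclosed subspace A of X is of the form A = {z}^⊥⊥ for some z ∈ A. -/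
namespace Orthoset

variable {X : Type*} [Orthoset X]

/-- `X` is a Dacey space: `C(X)` is orthomodular, i.e. for orthoclosed `B ⊆ A` one has
`A = B ∨ (A ∩ B^⊥)`. -/
def IsDacey (X : Type*) [Orthoset X] : Prop :=
  ∀ A B : Set X, Orthoclosed A → Orthoclosed B → B ⊆ A →
    A = ortho (ortho (B ∪ (A ∩ ortho B)))

/-- A subset `A` of `X`, regarded as an orthoset with the restricted relation and falsity `0`,
is unital: it possesses a proper element `z` such that no proper element of `A` is
orthogonal to `z`. -/
def UnitalSub {X : Type*} [Orthoset X] (A : Set X) : Prop :=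
  ∃ z ∈ A, z ≠ 0 ∧ ∀ y ∈ A, perp y z → y = 0

end Orthoset

open Orthoset

/-- (i) For any proper element `x` of an orthoset `X`, the subspace `{x}^⊥⊥` is unital.
(ii) If `X` is a Dacey space, then every unital orthoclosed subspace `A` of `X` is of the
form `A = {z}^⊥⊥` for some `z ∈ A`. -/
theorem stmt3 {X : Type*} [Orthoset X] :
    (∀ x : X, x ≠ 0 → UnitalSub (ortho (ortho ({x} : Set X)))) ∧
    (IsDacey X → ∀ A : Set X, Orthoclosed A → UnitalSub A →
      ∃ z ∈ A, A = ortho (ortho ({z} : Set X))) := by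
  have mem_dd : ∀ x : X, x ∈ ortho (ortho ({x} : Set X)) :=
    fun x y hy => perp_comm _ _ (hy x rfl)
  refine ⟨fun x hx => ⟨x, mem_dd x, hx, fun y hy hyx => ?_⟩, ?_⟩
  · refine perp_self y (hy y ?_)
    rintro w rfl
    exact hyx
  · rintro hD A hA ⟨z, hzA, -, hz⟩
    refine ⟨z, hzA, ?_⟩
    have closed : Orthoclosed (ortho (ortho ({z} : Set X))) := by
      apply Set.Subset.antisymm
      · intro y hy w hw
        exact hy w (fun v hv => perp_comm _ _ (hv w hw))
      · intro y hy w hw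
        exact perp_comm _ _ (hw y hy)
    have sub : ortho (ortho ({z} : Set X)) ⊆ A := by
      intro y hy
      rw [← hA]
      intro w hw
      apply hy
      rintro v rfl
      exact hw v hzA
    apply Set.Subset.antisymm _ sub
    intro y hy
    rw [hD A _ hA closed sub] at hy
    rw [← closed]
    intro w hw
    apply hy
    rintro v (hv | ⟨hvA, hv⟩)
    · exact hw v hv
    · rw [hz v hvA (hv z (mem_dd z))]
      exact perp_comm _ _ (zero_perp w)
end

section
/- Let X and Y be orthosets and f : X → Y a map. The following are equivalent: (a) f is an orthoisomorphism; (b) f is bijective and f⁻¹ is an adjoint of f; (c) f is bijective and adjointable, and for every adjoint g of f one has g ∘ f ∥ id_X (i.e., {g(f(x))}^⊥ = {x}^⊥ for all x ∈ X). -/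
namespace Orthoset

variable {X : Type*} [Orthoset X]

/-- `g` is an adjoint of `f`: for all `x, y`, `f x ⊥ y` iff `x ⊥ g y`. -/
def IsAdjoint {Y : Type*} [Orthoset Y] (f : X → Y) (g : Y → X) : Prop :=
  ∀ (x : X) (y : Y), perp (f x) y ↔ perp x (g y)

end Orthoset

open Orthoset
/-- For a map `f : X → Y` between orthosets, the following are equivalent:
(a) `f` is an orthoisomorphism (a bijection such that `x₁ ⊥ x₂` iff `f x₁ ⊥ f x₂`);
(b) `f` is bijective and `f⁻¹` is an adjoint of `f`;
(c) `f` is bijective and adjointable, and `g ∘ f ∥ id` for every adjoint `g` of `f`. -/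
theorem stmt11 {X Y : Type*} [Orthoset X] [Orthoset Y] (f : X → Y) :
    ((Function.Bijective f ∧
        ∀ x₁ x₂ : X, Orthoset.perp x₁ x₂ ↔ Orthoset.perp (f x₁) (f x₂)) ↔
      (Function.Bijective f ∧ ∃ g : Y → X,
        Function.LeftInverse g f ∧ Function.RightInverse g f ∧ IsAdjoint f g)) ∧
    ((Function.Bijective f ∧ ∃ g : Y → X,
        Function.LeftInverse g f ∧ Function.RightInverse g f ∧ IsAdjoint f g) ↔
      (Function.Bijective f ∧ (∃ g : Y → X, IsAdjoint f g) ∧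
        ∀ g : Y → X, IsAdjoint f g →
          ∀ x : X, ortho ({g (f x)} : Set X) = ortho ({x} : Set X))) := by
  have key : ∀ (g : Y → X) (x : X), ortho ({g (f x)} : Set X) = ortho ({x} : Set X) ↔
      ∀ z, perp z (g (f x)) ↔ perp z x := by
    intro g x
    simp [ortho, Set.ext_iff]
  refine ⟨⟨?_, ?_⟩, ⟨?_, ?_⟩⟩
  · rintro ⟨hb, h⟩
    obtain ⟨g, hl, hr⟩ := Function.bijective_iff_has_inverse.1 hb
    refine ⟨hb, g, hl, hr, fun x y => ?_⟩
    rw [h x (g y), hr y]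
  · rintro ⟨hb, g, hl, hr, h⟩
    refine ⟨hb, fun x y => ?_⟩
    rw [h x (f y), hl y]
  · rintro ⟨hb, g, hl, hr, h⟩
    refine ⟨hb, ⟨g, h⟩, fun k hk x => (key k x).2 fun z => ?_⟩
    rw [← hk z (f x), h z (f x), hl x]
  · rintro ⟨hb, ⟨k, hk⟩, h⟩
    obtain ⟨g, hl, hr⟩ := Function.bijective_iff_has_inverse.1 hb
    refine ⟨hb, g, hl, hr, fun x y => ?_⟩
    have h1 := (key k (g y)).1 (h k hk (g y)) x
    rw [hr y] at h1
    rw [hk x y, h1]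
end

section
/- Let X and Y be orthosets and let f : X → Y and g : Y → X be an adjoint pair of maps. The following are equivalent: (a) the image f(X) is orthoclosed and g(f(x)) = x for all x ∈ X; (b) f(X) is orthoclosed, the corestriction of f is an orthoisomorphism from X onto the orthoset f(X) (with restricted relation) whose inverse is the restriction of g to f(X), and the kernel of g equals (f(X))^⊥. -/
open Orthoset
/-- Let `f : X → Y` and `g : Y → X` be an adjoint pair of maps between orthosets. The
following are equivalent:
(a) the image `f(X)` is orthoclosed and `g (f x) = x` for all `x`;
(b) `f(X)` is orthoclosed, the corestriction of `f` is an orthoisomorphism of `X` onto the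
orthoset `f(X)` whose inverse is the restriction of `g` to `f(X)`, and the kernel of `g`
equals `(f(X))^⊥`. -/
theorem stmt12 {X Y : Type*} [Orthoset X] [Orthoset Y]
    (f : X → Y) (g : Y → X) (hfg : IsAdjoint f g) :
    (Orthoclosed (Set.range f) ∧ ∀ x : X, g (f x) = x) ↔
    (Orthoclosed (Set.range f) ∧ Function.Injective f ∧
      (∀ x₁ x₂ : X, Orthoset.perp x₁ x₂ ↔ Orthoset.perp (f x₁) (f x₂)) ∧
      (∀ x : X, g (f x) = x) ∧ (∀ y ∈ Set.range f, f (g y) = y) ∧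
      {y : Y | g y = 0} = ortho (Set.range f)) := by
  constructor
  · rintro ⟨hc, h⟩
    refine ⟨hc, fun a b hab => ?_, fun a b => ?_, h, ?_, ?_⟩
    · rw [← h a, ← h b, hab]
    · rw [hfg a (f b), h b]
    · rintro _ ⟨x, rfl⟩
      rw [h x]
    · ext y
      constructor
      · rintro hy _ ⟨x, rfl⟩
        have hy' : g y = 0 := hy
        apply perp_comm
        rw [hfg x y, hy']
        exact perp_comm _ _ (zero_perp x)
      · intro hy
        exact perp_self _ ((hfg (g y) y).1 (perp_comm _ _ (hy _ ⟨g y, rfl⟩)))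
  · rintro ⟨hc, _, _, h, _⟩
    exact ⟨hc, h⟩
end

section
/- Let X be an orthoset and p : X → X a self-adjoint map (i.e., for all x, y ∈ X: p(x) ⊥ y iff x ⊥ p(y)). Then the following are equivalent: (a) p is idempotent and the image p(X) is orthoclosed; (b) p(X) is orthoclosed, p(x) = x for every x ∈ p(X), and p(x) = 0 for every x ∈ (p(X))^⊥. -/
open Orthoset
/-- Let `p : X → X` be a self-adjoint map on an orthoset `X` (i.e. `p x ⊥ y` iff `x ⊥ p y`).
The following are equivalent:
(a) `p` is idempotent and the image `p(X)` is orthoclosed;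
(b) `p(X)` is orthoclosed, `p` is the identity on `p(X)`, and `p` vanishes on `(p(X))^⊥`. -/
theorem stmt13 {X : Type*} [Orthoset X] (p : X → X) (hp : IsAdjoint p p) :
    ((∀ x : X, p (p x) = p x) ∧ Orthoclosed (Set.range p)) ↔
    (Orthoclosed (Set.range p) ∧ (∀ x ∈ Set.range p, p x = x) ∧
      ∀ x ∈ ortho (Set.range p), p x = 0) := by
  constructor
  · rintro ⟨h1, h2⟩
    refine ⟨h2, ?_, ?_⟩
    · rintro _ ⟨y, rfl⟩
      exact h1 y
    · intro x hx
      exact perp_self _ ((hp x (p x)).2 (hx _ ⟨p x, rfl⟩))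
  · rintro ⟨h1, h2, _⟩
    exact ⟨fun x => h2 _ ⟨x, rfl⟩, h1⟩
end

section
/- Let H be a complex Hilbert space and U a unitary operator on H. Then U possesses a strict square root: there exists a unitary operator V on H such that V ∘ V = U and, for every orthogonal projection P on H, P commutes with U if and only if P commutes with V. -/
theorem kerProj_aux {H : Type*} [NormedAddCommGroup H] [InnerProductSpace ℂ H]
    [CompleteSpace H] (N : H →L[ℂ] H) (hN : star N = N) :
    ∃ Q : H →L[ℂ] H, Q * Q = Q ∧ star Q = Q ∧ Q * N = 0 ∧
      (∀ T : H →L[ℂ] H, N * T = 0 → Q * T = T) ∧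
      (∀ T : H →L[ℂ] H, star T = T → N * T = T * N → Q * T = T * Q) := by
  have hcl : IsClosed (N.ker : Set H) := N.isClosed_ker
  have : CompleteSpace N.ker := hcl.completeSpace_coe
  set Q : H →L[ℂ] H := N.ker.starProjection with hQ
  have hQs : star Q = Q := (isSelfAdjoint_starProjection N.ker).star_eq
  have hfix : ∀ T : H →L[ℂ] H, N * T = 0 → Q * T = T := by
    intro T hT
    ext x
    have hx : T x ∈ N.ker := by
      have := congrArg (fun f : H →L[ℂ] H => f x) hT
      simpa using this
    exact Submodule.starProjection_eq_self_iff.mpr hx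
  have hNQ : N * Q = 0 := by
    ext x
    have : Q x ∈ N.ker := Submodule.starProjection_apply_mem _ x
    simpa using this
  have hQN : Q * N = 0 := by
    have := congrArg star hNQ
    simpa [hN, hQs] using this
  refine ⟨Q, hfix Q hNQ, hQs, hQN, hfix, ?_⟩
  intro T hT hc
  have h1 : Q * (T * Q) = T * Q := by
    apply hfix
    rw [← mul_assoc, hc, mul_assoc, hNQ, mul_zero]
  have h2 := congrArg star h1
  simp only [star_mul, hT, hQs] at h2
  rw [← h2, mul_assoc, h1]

/-- Every unitary operator `U` on a complex Hilbert space `H` possesses a strict square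
root: a unitary `V` with `V ∘ V = U` such that an orthogonal projection on `H` commutes
with `U` exactly when it commutes with `V`. -/
theorem stmt15 {H : Type*} [NormedAddCommGroup H] [InnerProductSpace ℂ H]
    [CompleteSpace H] (U : H →L[ℂ] H) (hU : U ∈ unitary (H →L[ℂ] H)) :
    ∃ V : H →L[ℂ] H, V ∈ unitary (H →L[ℂ] H) ∧ V * V = U ∧
      ∀ P : H →L[ℂ] H, P * P = P → IsSelfAdjoint P →
        (P * U = U * P ↔ P * V = V * P) := by
  have hn : IsStarNormal U := by
    refine ⟨?_⟩
    rw [Commute, SemiconjBy, hU.1, hU.2]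
  have hsp : ∀ z ∈ spectrum ℂ U, z.re * z.re + z.im * z.im = 1 := by
    intro z hz
    have h1 : ‖z‖ = 1 := by
      have := spectrum.subset_circle_of_unitary hU hz
      simpa using this
    rw [← Complex.normSq_apply, Complex.normSq_eq_norm_sq, h1]; norm_num
  -- real functions on the spectrum
  have key : ∀ f g : ℂ → ℝ, Continuous f → Continuous g →
      cfc (fun z => (f z : ℂ)) U * cfc (fun z => (g z : ℂ)) U
        = cfc (fun z => ((f z * g z : ℝ) : ℂ)) U := by
    intro f g hf hg
    rw [← cfc_mul _ _ U (by fun_prop) (by fun_prop)]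
    simp
  have hstar : ∀ f : ℂ → ℝ, star (cfc (fun z => (f z : ℂ)) U) = cfc (fun z => (f z : ℂ)) U := by
    intro f
    rw [← cfc_star]
    simp
  have hcomm : ∀ f g : ℂ → ℝ,
      cfc (fun z => (f z : ℂ)) U * cfc (fun z => (g z : ℂ)) U
        = cfc (fun z => (g z : ℂ)) U * cfc (fun z => (f z : ℂ)) U := by
    intro f g
    exact cfc_commute_cfc _ _ U
  let a : ℂ → ℝ := fun z => Real.sqrt ((1 + z.re) / 2)
  let b : ℂ → ℝ := fun z => Real.sqrt ((1 - z.re) / 2)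
  let n : ℂ → ℝ := fun z => max (-z.im) 0
  let p : ℂ → ℝ := fun z => max z.im 0
  have ha : Continuous a := by fun_prop
  have hb : Continuous b := by fun_prop
  have hnc : Continuous n := by fun_prop
  have hp : Continuous p := by fun_prop
  have hre : ∀ z ∈ spectrum ℂ U, 0 ≤ (1 + z.re) / 2 ∧ 0 ≤ (1 - z.re) / 2 := by
    intro z hz
    have := hsp z hz
    constructor <;> nlinarith [mul_self_nonneg z.im]
  obtain ⟨A, hA⟩ : ∃ A, A = cfc (fun z => (a z : ℂ)) U := ⟨_, rfl⟩
  obtain ⟨B, hB⟩ : ∃ A, A = cfc (fun z => (b z : ℂ)) U := ⟨_, rfl⟩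
  obtain ⟨N, hN⟩ : ∃ A, A = cfc (fun z => (n z : ℂ)) U := ⟨_, rfl⟩
  obtain ⟨M, hM⟩ : ∃ A, A = cfc (fun z => (p z : ℂ)) U := ⟨_, rfl⟩
  have hAs : star A = A := by rw [hA]; exact hstar a
  have hBs : star B = B := by rw [hB]; exact hstar b
  have hNs : star N = N := by rw [hN]; exact hstar n
  have hAB : A * B = B * A := by rw [hA, hB]; exact hcomm a b
  have hNA : N * A = A * N := by rw [hA, hN]; exact hcomm n a
  have hNB : N * B = B * N := by rw [hB, hN]; exact hcomm n b
  have hNM : N * M = 0 := by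
    rw [hN, hM, key n p hnc hp, ← cfc_zero ℂ U]
    congr 1
    funext z
    simp only [n, p, Pi.zero_apply, Complex.ofReal_eq_zero]
    rcases le_total 0 z.im with h | h
    · rw [max_eq_right (by linarith), zero_mul]
    · rw [max_eq_right h, mul_zero]
  have hone : A * A + B * B = 1 := by
    rw [hA, hB, key a a ha ha, key b b hb hb, ← cfc_add U _ _ (by fun_prop) (by fun_prop), 
      ← cfc_one ℂ U]
    apply cfc_congr
    intro z hz
    simp only [a, b, Pi.one_apply]
    rw [Real.mul_self_sqrt (hre z hz).1, Real.mul_self_sqrt (hre z hz).2]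
    push_cast; ring
  have hABM : (2 : ℂ) • (A * B) = M + N := by
    rw [hA, hB, hM, hN, key a b ha hb, ← cfc_add U _ _ (by fun_prop) (by fun_prop),
      ← cfc_smul _ _ _ (by fun_prop)]
    apply cfc_congr
    intro z hz
    simp only [a, b, p, n, smul_eq_mul]
    rw [← Real.sqrt_mul (hre z hz).1, 
      show (1 + z.re) / 2 * ((1 - z.re) / 2) = (|z.im| / 2) ^ 2 by
        rw [div_pow, sq_abs]; have := hsp z hz; linarith,
      Real.sqrt_sq (by positivity)]
    have : |z.im| = max z.im 0 + max (-z.im) 0 := by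
      rcases le_total 0 z.im with h | h
      · rw [abs_of_nonneg h, max_eq_left h, max_eq_right (by linarith), add_zero]
      · rw [abs_of_nonpos h, max_eq_right h, max_eq_left (by linarith), zero_add]
    rw [this]; push_cast; ring
  have hUd : A * A - B * B + Complex.I • (M - N) = U := by
    conv_rhs => rw [← cfc_id' ℂ U]
    rw [hA, hB, hM, hN, key a a ha ha, key b b hb hb, ← cfc_sub _ _ U (by fun_prop) (by fun_prop),
      ← cfc_sub _ _ U (by fun_prop) (by fun_prop), ← cfc_smul _ _ _ (by fun_prop),
      ← cfc_add U _ _ (by fun_prop) (by fun_prop)]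
    apply cfc_congr
    intro z hz
    simp only [a, b, p, n, smul_eq_mul]
    rw [Real.mul_self_sqrt (hre z hz).1, Real.mul_self_sqrt (hre z hz).2]
    have : z.im = max z.im 0 - max (-z.im) 0 := by
      rcases le_total 0 z.im with h | h
      · rw [max_eq_left h, max_eq_right (by linarith), sub_zero]
      · rw [max_eq_right h, max_eq_left (by linarith)]; ring
    rw [← Complex.ofReal_sub (max z.im 0), ← this]
    conv_rhs => rw [← Complex.re_add_im z]
    push_cast; ring
  obtain ⟨Q, hQQ, hQs, hQN, hQf, hQc⟩ := kerProj_aux N hNs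
  have hQM : Q * M = M := hQf M hNM
  have hQA : Q * A = A * Q := hQc A hAs hNA
  have hQB : Q * B = B * Q := hQc B hBs hNB
  obtain ⟨W, hW⟩ : ∃ W, W = Q + Q - 1 := ⟨_, rfl⟩
  have hWW : W * W = 1 := by
    rw [hW]; simp only [mul_sub, sub_mul, mul_add, add_mul, hQQ, mul_one, one_mul]; abel
  have hWs : star W = W := by rw [hW]; simp [hQs]
  have hWA : W * A = A * W := by
    rw [hW]; simp only [mul_sub, sub_mul, mul_add, add_mul, mul_one, one_mul, hQA]
  have hWB : W * B = B * W := by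
    rw [hW]; simp only [mul_sub, sub_mul, mul_add, add_mul, mul_one, one_mul, hQB]
  have hWM : W * (M + N) = M - N := by
    rw [hW]; simp only [sub_mul, mul_add, add_mul, one_mul, hQM, hQN]; abel
  have hBWs : star (W * B) = W * B := by rw [star_mul, hWs, hBs, hWB]
  obtain ⟨D, hD⟩ : ∃ D, D = W * B := ⟨_, rfl⟩
  have hDs : star D = D := by rw [hD, hBWs]
  have hDD : D * D = B * B := by
    rw [hD]; nth_rewrite 1 [hWB]
    rw [mul_assoc, ← mul_assoc W, hWW, one_mul]
  have hAD : A * D = D * A := by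
    rw [hD, ← mul_assoc, ← hWA, mul_assoc, hAB, mul_assoc]
  have hDA : (2 : ℂ) • (D * A) = M - N := by
    rw [hD, mul_assoc, ← hAB, ← mul_smul_comm, hABM, hWM]
  have hVs : star (A + Complex.I • D) = A - Complex.I • D := by
    rw [star_add, star_smul, hAs, hDs]
    simp [sub_eq_add_neg]
  have hVV : (A + Complex.I • D) * (A + Complex.I • D) = U := by
    rw [← hUd, ← hDA]
    simp only [mul_add, add_mul, smul_mul_assoc, mul_smul_comm, smul_smul, hDD, hAD,
      Complex.I_mul_I]
    match_scalars <;> ring_nf <;> simp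
  refine ⟨A + Complex.I • D, ?_, hVV, ?_⟩
  · rw [Unitary.mem_iff, hVs, ← hone, ← hDD]
    constructor
    all_goals
      simp only [mul_add, add_mul, mul_sub, sub_mul, smul_mul_assoc, mul_smul_comm, smul_smul, hAD,
        Complex.I_mul_I]
      match_scalars <;> ring_nf <;> simp
  · intro P _ hP
    have hPs : star P = P := hP.star_eq
    constructor
    · intro h
      have h' : P * star U = star U * P := by
        have h2 : star (P * U) = star (U * P) := by rw [h]
        rw [star_mul, star_mul, hPs] at h2
        exact h2.symm
      have hc : ∀ f : ℂ → ℂ, cfc f U * P = P * cfc f U := fun f =>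
        (Commute.cfc (a := U) (b := P) h.symm h'.symm f)
      have hPA : A * P = P * A := by rw [hA]; exact hc _
      have hPB : B * P = P * B := by rw [hB]; exact hc _
      have hPN : N * P = P * N := by rw [hN]; exact hc _
      have hPQ := hQc P hPs hPN
      have hPW : W * P = P * W := by
        rw [hW]; simp only [mul_sub, sub_mul, mul_add, add_mul, mul_one, one_mul, hPQ]
      have hPD : D * P = P * D := by
        rw [hD, mul_assoc, hPB, ← mul_assoc, hPW, mul_assoc]
      rw [mul_add, add_mul, hPA, mul_smul_comm, smul_mul_assoc, hPD]
    · intro h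
      rw [← hVV, ← mul_assoc, h, mul_assoc, h, mul_assoc]
end

section
/- Let H be a real Hilbert space of dimension at least 2. Then −id_H has no strict square root: there is no unitary operator V on H such that V ∘ V = −id_H and every orthogonal projection on H commutes with V. (Note that every orthogonal projection commutes with −id_H, so the commutation condition in the definition of a strict square root of −id_H amounts to requiring that every orthogonal projection commutes with V.) -/
/-- On a real Hilbert space `H` of dimension at least `2`, the unitary `-id` has no strict
square root: there is no unitary `V` with `V * V = -1` such that every orthogonal
projection on `H` commutes with `V`.  (Every orthogonal projection commutes with `-id`, so
the commutation condition in the definition of a strict square root of `-id` amounts to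
requiring that every orthogonal projection commutes with `V`.) -/
theorem stmt16 {H : Type*} [NormedAddCommGroup H] [InnerProductSpace ℝ H]
    [CompleteSpace H] (hdim : 2 ≤ Module.rank ℝ H) :
    ¬ ∃ V : H →L[ℝ] H, V ∈ unitary (H →L[ℝ] H) ∧ V * V = -1 ∧
        ∀ P : H →L[ℝ] H, P * P = P → IsSelfAdjoint P → P * V = V * P := by
  rintro ⟨V, -, hV, hP⟩
  have hpos : 0 < Module.rank ℝ H := lt_of_lt_of_le (by norm_num) hdim
  have : Nontrivial H := rank_pos_iff_nontrivial.mp hpos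
  obtain ⟨x, hx⟩ := exists_ne (0 : H)
  have hproj := isStarProjection_starProjection (U := Submodule.span ℝ {x})
  have hc := hP _ hproj.isIdempotentElem hproj.isSelfAdjoint
  have h1 := congrArg (fun T : H →L[ℝ] H => T x) hc
  simp only [ContinuousLinearMap.mul_apply] at h1
  rw [Submodule.starProjection_eq_self_iff.mpr (Submodule.mem_span_singleton_self x),
    Submodule.starProjection_singleton] at h1
  obtain ⟨c, h2⟩ : ∃ c : ℝ, c • x = V x := ⟨_, h1⟩
  have h3 := congrArg (fun T : H →L[ℝ] H => T x) hV
  simp only [ContinuousLinearMap.mul_apply, ← h2, map_smul, ContinuousLinearMap.neg_apply,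
    ContinuousLinearMap.one_apply] at h3
  have h4 : (c * c + 1) • x = 0 := by
    rw [add_smul, mul_smul, one_smul, h3]; simp
  rcases smul_eq_zero.mp h4 with h | h
  · nlinarith [mul_self_nonneg c]
  · exact hx h
end

section
/- Let H₁ and H₂ be complex Hilbert spaces and φ : H₁ → H₂ a linear map. The following are equivalent: (a) φ possesses a linear adjoint, i.e., there is a map ψ : H₂ → H₁ with ⟨φ(u), v⟩ = ⟨u, ψ(v)⟩ for all u ∈ H₁, v ∈ H₂; (b) φ, seen as a map between the orthosets underlying H₁ and H₂, is adjointable, i.e., there is a (not necessarily linear) map g : H₂ → H₁ such that for all u ∈ H₁ and v ∈ H₂: ⟨φ(u), v⟩ = 0 iff ⟨u, g(v)⟩ = 0. In this case the linear adjoint ψ itself satisfies the condition in (b). -/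
open scoped ComplexInnerProductSpace

/-- Let `φ : H₁ → H₂` be a linear map between complex Hilbert spaces. The following are
equivalent: (a) `φ` possesses a linear adjoint, i.e. a map `ψ : H₂ → H₁` with
`⟪φ u, v⟫ = ⟪u, ψ v⟫` for all `u, v`; (b) `φ`, seen as a map between the underlying
orthosets, is adjointable, i.e. there is a map `g : H₂ → H₁` with `⟪φ u, v⟫ = 0` iff
`⟪u, g v⟫ = 0`. In this case the linear adjoint `ψ` itself satisfies the condition
in (b). -/
theorem stmt17 {H₁ H₂ : Type*}
    [NormedAddCommGroup H₁] [InnerProductSpace ℂ H₁] [CompleteSpace H₁]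
    [NormedAddCommGroup H₂] [InnerProductSpace ℂ H₂] [CompleteSpace H₂]
    (φ : H₁ →ₗ[ℂ] H₂) :
    ((∃ ψ : H₂ → H₁, ∀ (u : H₁) (v : H₂), ⟪φ u, v⟫ = ⟪u, ψ v⟫) ↔
      (∃ g : H₂ → H₁, ∀ (u : H₁) (v : H₂), ⟪φ u, v⟫ = 0 ↔ ⟪u, g v⟫ = 0)) ∧
    (∀ ψ : H₂ → H₁, (∀ (u : H₁) (v : H₂), ⟪φ u, v⟫ = ⟪u, ψ v⟫) →
      ∀ (u : H₁) (v : H₂), ⟪φ u, v⟫ = 0 ↔ ⟪u, ψ v⟫ = 0) := by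
  refine ⟨⟨?_, ?_⟩, ?_⟩
  · rintro ⟨ψ, h⟩
    exact ⟨ψ, fun u v => by rw [h]⟩
  · rintro ⟨g, h⟩
    refine ⟨fun v => (⟪φ (g v), v⟫ / ⟪g v, g v⟫) • g v, fun u v => ?_⟩
    have hc : (starRingEnd ℂ) (⟪g v, u⟫ / ⟪g v, g v⟫) = ⟪u, g v⟫ / ⟪g v, g v⟫ := by
      rw [map_div₀, inner_conj_symm, inner_conj_symm]
    have h1 : ⟪u - (⟪g v, u⟫ / ⟪g v, g v⟫) • g v, g v⟫ = 0 := by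
      rw [inner_sub_left, inner_smul_left, hc]
      by_cases hw : g v = 0
      · simp [hw]
      · have : ⟪g v, g v⟫ ≠ 0 := inner_self_ne_zero.mpr hw
        field_simp
        simp
    have h2 := (h _ v).mpr h1
    rw [map_sub, map_smul, inner_sub_left, inner_smul_left, hc, sub_eq_zero] at h2
    rw [h2, inner_smul_right]
    ring
  · intro ψ h u v
    rw [h]
end
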